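/- If a lattice knot K satisfies δ_V(K) = 1, then every vertex of K is a corner of the minimal bounding box of K; consequently K lies on the boundary of its minimal bounding box and K is the unknot. -/

import Mathlib

/-- The ℓ¹-metric on ℤ³. -/
def d1 (a b : Fin 3 → ℤ) : ℤ := ∑ i, |a i - b i|

/-- A lattice knot with `n` unit edges, given by its cyclic sequence of vertices
(all lattice points of the knot): consecutive vertices are at ℓ¹-distance 1
(so each edge is a unit axis-parallel segment), the vertices are pairwise distinct
(the curve is embedded), and there are at least 4 of them. -/
structure LatticeKnot (n : ℕ) where
  vtx : ZMod n → (Fin 3 → ℤ)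
  inj : Function.Injective vtx
  step_unit : ∀ j, d1 (vtx (j + 1)) (vtx j) = 1
  big : 4 ≤ n

/-- The arc-distance along the knot between the `i`-th and `j`-th vertices:
the length of the shorter of the two arcs. -/
def dK {n : ℕ} (i j : ZMod n) : ℕ := min (j - i).val (i - j).val

/-- The vertex distortion of a lattice knot. -/
noncomputable def deltaV {n : ℕ} (K : LatticeKnot n) : ℝ :=
  sSup {x : ℝ | ∃ i j : ZMod n, i ≠ j ∧
    x = (dK i j : ℝ) / (d1 (K.vtx i) (K.vtx j) : ℝ)}

/-! ### Topological part -/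

/-- A gauge on the plane. -/
structure IsGauge (N : ℝ → ℝ → ℝ) : Prop where
  cont : Continuous (fun p : Fin 3 → ℝ => N (p 0) (p 1))
  hom : ∀ r a b : ℝ, 0 ≤ r → N (r * a) (r * b) = r * N a b
  left : ∀ a b, |a| ≤ N a b
  right : ∀ a b, |b| ≤ N a b

/-- Radial rescaling of the first two coordinates. -/
noncomputable def rescale (N M : ℝ → ℝ → ℝ) (p : Fin 3 → ℝ) : Fin 3 → ℝ :=
  ![N (p 0) (p 1) / M (p 0) (p 1) * p 0, N (p 0) (p 1) / M (p 0) (p 1) * p 1, p 2]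

theorem IsGauge.zero {N : ℝ → ℝ → ℝ} (hN : IsGauge N) : N 0 0 = 0 := by
  have := hN.hom 0 0 0 le_rfl
  simpa using this

theorem IsGauge.nonneg {N : ℝ → ℝ → ℝ} (hN : IsGauge N) (a b : ℝ) : 0 ≤ N a b :=
  (abs_nonneg a).trans (hN.left a b)

theorem IsGauge.eq_zero {N : ℝ → ℝ → ℝ} (hN : IsGauge N) {a b : ℝ} (h : N a b = 0) :
    a = 0 ∧ b = 0 := by
  have h1 := hN.left a b
  have h2 := hN.right a b
  rw [h] at h1 h2
  exact ⟨abs_nonpos_iff.1 h1, abs_nonpos_iff.1 h2⟩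

theorem rescale_cont_aux {N M : ℝ → ℝ → ℝ} (hN : IsGauge N) (hM : IsGauge M)
    (c : Fin 3) (hc : ∀ p : Fin 3 → ℝ, |p c| ≤ M (p 0) (p 1)) :
    Continuous (fun p : Fin 3 → ℝ => N (p 0) (p 1) / M (p 0) (p 1) * p c) := by
  rw [continuous_iff_continuousAt]
  intro p
  by_cases h : M (p 0) (p 1) = 0
  · obtain ⟨h0, h1⟩ := hM.eq_zero h
    have hNz : N (p 0) (p 1) = 0 := by rw [h0, h1, hN.zero]
    have ht : Filter.Tendsto (fun q : Fin 3 → ℝ => N (q 0) (q 1)) (nhds p) (nhds 0) := by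
      have := hN.cont.tendsto p
      simpa only [hNz] using this
    have hz : N (p 0) (p 1) / M (p 0) (p 1) * p c = 0 := by rw [hNz]; simp
    change Filter.Tendsto _ (nhds p) (nhds (N (p 0) (p 1) / M (p 0) (p 1) * p c))
    rw [hz]
    refine squeeze_zero_norm (fun q => ?_) ht
    rw [Real.norm_eq_abs, abs_mul, abs_div, abs_of_nonneg (hN.nonneg _ _),
      abs_of_nonneg (hM.nonneg _ _), div_mul_eq_mul_div]
    exact div_le_of_le_mul₀ (hM.nonneg _ _) (hN.nonneg _ _)
      (mul_le_mul_of_nonneg_left (hc q) (hN.nonneg _ _))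
  · exact (hN.cont.continuousAt.div hM.cont.continuousAt h).mul (continuous_apply c).continuousAt

theorem rescale_cont {N M : ℝ → ℝ → ℝ} (hN : IsGauge N) (hM : IsGauge M) :
    Continuous (rescale N M) := by
  refine continuous_pi fun i => ?_
  fin_cases i
  · exact rescale_cont_aux hN hM 0 fun p => hM.left _ _
  · exact rescale_cont_aux hN hM 1 fun p => hM.right _ _
  · exact continuous_apply 2

theorem rescale_gauge {N M : ℝ → ℝ → ℝ} (hN : IsGauge N) (hM : IsGauge M) (p : Fin 3 → ℝ) :
    M (rescale N M p 0) (rescale N M p 1) = N (p 0) (p 1) := by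
  have : M (rescale N M p 0) (rescale N M p 1) =
      N (p 0) (p 1) / M (p 0) (p 1) * M (p 0) (p 1) :=
    hM.hom _ _ _ (div_nonneg (hN.nonneg _ _) (hM.nonneg _ _))
  rw [this]
  by_cases h : M (p 0) (p 1) = 0
  · obtain ⟨h0, h1⟩ := hM.eq_zero h
    rw [h0, h1, hN.zero, hM.zero]; simp
  · field_simp

theorem rescale_inv {N M : ℝ → ℝ → ℝ} (hN : IsGauge N) (hM : IsGauge M) (p : Fin 3 → ℝ) :
    rescale M N (rescale N M p) = p := by
  have hg := rescale_gauge hN hM p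
  have hg2 : N (rescale N M p 0) (rescale N M p 1) =
      N (p 0) (p 1) / M (p 0) (p 1) * N (p 0) (p 1) :=
    hN.hom _ _ _ (div_nonneg (hN.nonneg _ _) (hM.nonneg _ _))
  have key : ∀ t, (M (p 0) (p 1) = 0 → t = 0) →
      M (rescale N M p 0) (rescale N M p 1) / N (rescale N M p 0) (rescale N M p 1) *
        (N (p 0) (p 1) / M (p 0) (p 1) * t) = t := by
    intro t ht
    rw [hg, hg2]
    by_cases h : M (p 0) (p 1) = 0
    · rw [ht h]; simp
    · have h' : N (p 0) (p 1) ≠ 0 := by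
        intro h'
        obtain ⟨h0, h1⟩ := hN.eq_zero h'
        exact h (by rw [h0, h1, hM.zero])
      field_simp
  funext i
  fin_cases i
  · exact key (p 0) fun h => (hM.eq_zero h).1
  · exact key (p 1) fun h => (hM.eq_zero h).2
  · rfl

/-- Radial rescaling as a homeomorphism. -/
noncomputable def rescaleHomeo {N M : ℝ → ℝ → ℝ} (hN : IsGauge N) (hM : IsGauge M) :
    (Fin 3 → ℝ) ≃ₜ (Fin 3 → ℝ) where
  toFun := rescale N M
  invFun := rescale M N
  left_inv := rescale_inv hN hM
  right_inv := rescale_inv hM hN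
  continuous_toFun := rescale_cont hN hM
  continuous_invFun := rescale_cont hM hN

theorem isGauge_sqrt : IsGauge (fun a b => Real.sqrt (a ^ 2 + b ^ 2)) where
  cont := by fun_prop
  hom := by
    intro r a b hr
    have : (r * a) ^ 2 + (r * b) ^ 2 = r ^ 2 * (a ^ 2 + b ^ 2) := by ring
    simp only [this]
    rw [Real.sqrt_mul (sq_nonneg r), Real.sqrt_sq hr]
  left := fun a b => Real.abs_le_sqrt (by nlinarith [sq_nonneg b])
  right := fun a b => Real.abs_le_sqrt (by nlinarith [sq_nonneg a])

theorem isGauge_max : IsGauge (fun a b => max |a| |b|) where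
  cont := by fun_prop
  hom := by
    intro r a b hr
    simp only [abs_mul, abs_of_nonneg hr]
    rw [mul_max_of_nonneg _ _ hr]
  left := fun a b => le_max_left _ _
  right := fun a b => le_max_right _ _

theorem isGauge_hex : IsGauge (fun a b => max (max a b) 0 - min (min a b) 0) where
  cont := by fun_prop
  hom := by
    intro r a b hr
    rw [mul_sub, mul_max_of_nonneg _ _ hr, mul_max_of_nonneg _ _ hr, mul_min_of_nonneg _ _ hr,
      mul_min_of_nonneg _ _ hr, mul_zero]
  left := by intro a b; grind
  right := by intro a b; grind

theorem gauge_circle {N : ℝ → ℝ → ℝ} (hN : IsGauge N) :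
    ∃ F : (Fin 3 → ℝ) ≃ₜ (Fin 3 → ℝ), F '' {p | N (p 0) (p 1) = 1 ∧ p 2 = 0} =
      {p : Fin 3 → ℝ | p 0 ^ 2 + p 1 ^ 2 = 1 ∧ p 2 = 0} := by
  refine ⟨rescaleHomeo hN isGauge_sqrt, ?_⟩
  rw [Homeomorph.image_eq_preimage_symm]
  ext p
  have h := rescale_gauge isGauge_sqrt hN p
  have h2 : rescale (fun a b => Real.sqrt (a ^ 2 + b ^ 2)) N p 2 = p 2 := rfl
  change N (rescale (fun a b => Real.sqrt (a ^ 2 + b ^ 2)) N p 0)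
    (rescale (fun a b => Real.sqrt (a ^ 2 + b ^ 2)) N p 1) = 1 ∧
    rescale (fun a b => Real.sqrt (a ^ 2 + b ^ 2)) N p 2 = 0 ↔ _
  rw [h, h2, Real.sqrt_eq_one]
  rfl

/-- The shear flattening the hexagon. -/
noncomputable def hexHomeo : (Fin 3 → ℝ) ≃ₜ (Fin 3 → ℝ) where
  toFun p := ![(p 0 - p 2) / 2, (p 1 - p 2) / 2,
    (max (max (p 0) (p 1)) (p 2) + min (min (p 0) (p 1)) (p 2)) / 2]
  invFun q :=
    ![2 * q 0 + (q 2 - (max (max (q 0) (q 1)) 0 + min (min (q 0) (q 1)) 0)),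
      2 * q 1 + (q 2 - (max (max (q 0) (q 1)) 0 + min (min (q 0) (q 1)) 0)),
      q 2 - (max (max (q 0) (q 1)) 0 + min (min (q 0) (q 1)) 0)]
  left_inv := by
    intro p
    funext i
    fin_cases i <;> (simp; grind)
  right_inv := by
    intro p
    funext i
    fin_cases i <;> simp <;> grind
  continuous_toFun := by
    refine continuous_pi fun i => ?_
    fin_cases i <;> simp <;> fun_prop
  continuous_invFun := by
    refine continuous_pi fun i => ?_
    fin_cases i <;> simp <;> fun_prop

/-- The standard hexagon. -/
def hexSet : Set (Fin 3 → ℝ) :=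
  {p | max (max (p 0) (p 1)) (p 2) = 1 ∧ min (min (p 0) (p 1)) (p 2) = -1}

/-- The standard square. -/
def sqSet : Set (Fin 3 → ℝ) := {p | max |p 0| |p 1| = 1 ∧ p 2 = 0}

theorem hex_max (x y z : ℝ) :
    max (max ((x - z) / 2) ((y - z) / 2)) 0 = (max (max x y) z - z) / 2 := by
  simp only [max_def]
  split_ifs <;> linarith

theorem hex_min (x y z : ℝ) :
    min (min ((x - z) / 2) ((y - z) / 2)) 0 = (min (min x y) z - z) / 2 := by
  simp only [min_def]
  split_ifs <;> linarith

theorem hexSet_circle : ∃ F : (Fin 3 → ℝ) ≃ₜ (Fin 3 → ℝ), F '' hexSet =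
      {p : Fin 3 → ℝ | p 0 ^ 2 + p 1 ^ 2 = 1 ∧ p 2 = 0} := by
  obtain ⟨F, hF⟩ := gauge_circle isGauge_hex
  refine ⟨hexHomeo.trans F, ?_⟩
  have hc : ⇑(hexHomeo.trans F) = F ∘ hexHomeo := rfl
  rw [← hF, hc, Set.image_comp]
  congr 1
  have key : ∀ p, hexHomeo p ∈ {p : Fin 3 → ℝ |
      max (max (p 0) (p 1)) 0 - min (min (p 0) (p 1)) 0 = 1 ∧ p 2 = 0} ↔ p ∈ hexSet := by
    intro p
    change max (max ((p 0 - p 2) / 2) ((p 1 - p 2) / 2)) 0 -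
      min (min ((p 0 - p 2) / 2) ((p 1 - p 2) / 2)) 0 = 1 ∧
      (max (max (p 0) (p 1)) (p 2) + min (min (p 0) (p 1)) (p 2)) / 2 = 0 ↔
      max (max (p 0) (p 1)) (p 2) = 1 ∧ min (min (p 0) (p 1)) (p 2) = -1
    rw [hex_max, hex_min]
    constructor
    · rintro ⟨h1, h2⟩
      constructor <;> linarith
    · rintro ⟨h1, h2⟩
      rw [h1, h2]
      constructor <;> ring
  ext q
  constructor
  · rintro ⟨p, hp, rfl⟩
    exact (key p).2 hp
  · intro hq
    refine ⟨hexHomeo.symm q, (key _).1 ?_, hexHomeo.apply_symm_apply q⟩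
    rwa [hexHomeo.apply_symm_apply]

theorem sqSet_circle : ∃ F : (Fin 3 → ℝ) ≃ₜ (Fin 3 → ℝ), F '' sqSet =
      {p : Fin 3 → ℝ | p 0 ^ 2 + p 1 ^ 2 = 1 ∧ p 2 = 0} := gauge_circle isGauge_max

theorem hex_union (w : ZMod 6 → Fin 3 → ℝ) (h0 : w 0 = ![-1, 1, -1]) (h1 : w 1 = ![1, 1, -1])
    (h2 : w 2 = ![1, -1, -1]) (h3 : w 3 = ![1, -1, 1]) (h4 : w 4 = ![-1, -1, 1])
    (h5 : w 5 = ![-1, 1, 1]) : ⋃ j, segment ℝ (w j) (w (j + 1)) = hexSet := by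
  have e6 : (5 + 1 : ZMod 6) = 0 := rfl
  have e1 : (0 + 1 : ZMod 6) = 1 := rfl
  have e2 : (1 + 1 : ZMod 6) = 2 := rfl
  have e3 : (2 + 1 : ZMod 6) = 3 := rfl
  have e4 : (3 + 1 : ZMod 6) = 4 := rfl
  have e5 : (4 + 1 : ZMod 6) = 5 := rfl
  have hcases : ∀ j : ZMod 6, j = 0 ∨ j = 1 ∨ j = 2 ∨ j = 3 ∨ j = 4 ∨ j = 5 := by decide
  ext p
  simp only [Set.mem_iUnion]
  constructor
  · rintro ⟨j, α, β, hα, hβ, hs, rfl⟩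
    rcases hcases j with rfl | rfl | rfl | rfl | rfl | rfl <;>
      simp only [e1, e2, e3, e4, e5, e6, h0, h1, h2, h3, h4, h5, hexSet, Set.mem_ofPred_eq] <;>
      simp <;> constructor <;> grind
  · rintro ⟨hM, hm⟩
    have hx : p 0 ≤ 1 ∧ -1 ≤ p 0 := by grind
    have hy : p 1 ≤ 1 ∧ -1 ≤ p 1 := by grind
    have hz : p 2 ≤ 1 ∧ -1 ≤ p 2 := by grind
    have hc : (p 1 = 1 ∧ p 2 = -1) ∨ (p 0 = 1 ∧ p 2 = -1) ∨ (p 0 = 1 ∧ p 1 = -1) ∨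
      (p 1 = -1 ∧ p 2 = 1) ∨ (p 0 = -1 ∧ p 2 = 1) ∨ (p 0 = -1 ∧ p 1 = 1) := by grind
    have fin : ∀ (j : ZMod 6) (α : ℝ), 0 ≤ α → α ≤ 1 →
        (∀ i, α * w j i + (1 - α) * w (j + 1) i = p i) →
        ∃ j, p ∈ segment ℝ (w j) (w (j + 1)) := by
      intro j α ha hb h
      exact ⟨j, α, 1 - α, ha, by linarith, by ring, funext h⟩
    rcases hc with ⟨ha, hb⟩ | ⟨ha, hb⟩ | ⟨ha, hb⟩ | ⟨ha, hb⟩ | ⟨ha, hb⟩ | ⟨ha, hb⟩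
    · refine fin 0 ((1 - p 0) / 2) (by linarith) (by linarith) fun i => ?_
      rw [e1, h0, h1]; fin_cases i <;> simp [ha, hb] <;> ring
    · refine fin 1 ((1 + p 1) / 2) (by linarith) (by linarith) fun i => ?_
      rw [e2, h1, h2]; fin_cases i <;> simp [ha, hb] <;> ring
    · refine fin 2 ((1 - p 2) / 2) (by linarith) (by linarith) fun i => ?_
      rw [e3, h2, h3]; fin_cases i <;> simp [ha, hb] <;> ring
    · refine fin 3 ((1 + p 0) / 2) (by linarith) (by linarith) fun i => ?_
      rw [e4, h3, h4]; fin_cases i <;> simp [ha, hb] <;> ring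
    · refine fin 4 ((1 - p 1) / 2) (by linarith) (by linarith) fun i => ?_
      rw [e5, h4, h5]; fin_cases i <;> simp [ha, hb] <;> ring
    · refine fin 5 ((1 + p 2) / 2) (by linarith) (by linarith) fun i => ?_
      rw [e6, h5, h0]; fin_cases i <;> simp [ha, hb] <;> ring

theorem sq_union (w : ZMod 4 → Fin 3 → ℝ) (h0 : w 0 = ![-1, -1, 0]) (h1 : w 1 = ![1, -1, 0])
    (h2 : w 2 = ![1, 1, 0]) (h3 : w 3 = ![-1, 1, 0]) :
    ⋃ j, segment ℝ (w j) (w (j + 1)) = sqSet := by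
  have e1 : (0 + 1 : ZMod 4) = 1 := rfl
  have e2 : (1 + 1 : ZMod 4) = 2 := rfl
  have e3 : (2 + 1 : ZMod 4) = 3 := rfl
  have e4 : (3 + 1 : ZMod 4) = 0 := rfl
  have hcases : ∀ j : ZMod 4, j = 0 ∨ j = 1 ∨ j = 2 ∨ j = 3 := by decide
  ext p
  simp only [Set.mem_iUnion]
  constructor
  · rintro ⟨j, α, β, hα, hβ, hs, rfl⟩
    rcases hcases j with rfl | rfl | rfl | rfl <;>
      simp only [e1, e2, e3, e4, h0, h1, h2, h3, sqSet, Set.mem_ofPred_eq] <;>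
      simp <;> simp only [abs_eq_max_neg] <;> grind
  · rintro ⟨hM, hz⟩
    have hx : p 0 ≤ 1 ∧ -1 ≤ p 0 := by grind
    have hy : p 1 ≤ 1 ∧ -1 ≤ p 1 := by grind
    have hc : p 1 = -1 ∨ p 0 = 1 ∨ p 1 = 1 ∨ p 0 = -1 := by grind
    have fin : ∀ (j : ZMod 4) (α : ℝ), 0 ≤ α → α ≤ 1 →
        (∀ i, α * w j i + (1 - α) * w (j + 1) i = p i) →
        ∃ j, p ∈ segment ℝ (w j) (w (j + 1)) := by
      intro j α ha hb h
      exact ⟨j, α, 1 - α, ha, by linarith, by ring, funext h⟩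
    rcases hc with ha | ha | ha | ha
    · refine fin 0 ((1 - p 0) / 2) (by linarith) (by linarith) fun i => ?_
      rw [e1, h0, h1]; fin_cases i <;> simp [ha, hz] <;> ring
    · refine fin 1 ((1 - p 1) / 2) (by linarith) (by linarith) fun i => ?_
      rw [e2, h1, h2]; fin_cases i <;> simp [ha, hz] <;> ring
    · refine fin 2 ((1 + p 0) / 2) (by linarith) (by linarith) fun i => ?_
      rw [e3, h2, h3]; fin_cases i <;> simp [ha, hz] <;> ring
    · refine fin 3 ((1 + p 1) / 2) (by linarith) (by linarith) fun i => ?_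
      rw [e4, h3, h0]; fin_cases i <;> simp [ha, hz] <;> ring

/-- Signed affine change of coordinates. -/
noncomputable def affHomeo (σ : Equiv.Perm (Fin 3)) (s m : Fin 3 → ℝ) (hs : ∀ i, s i ≠ 0) :
    (Fin 3 → ℝ) ≃ₜ (Fin 3 → ℝ) where
  toFun p i := s i * (2 * p (σ i) - m i)
  invFun q i := (q (σ.symm i) / s (σ.symm i) + m (σ.symm i)) / 2
  left_inv := by
    intro p
    funext i
    have := hs (σ.symm i)
    simp only [Equiv.apply_symm_apply]
    field_simp
    ring
  right_inv := by
    intro p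
    funext i
    have := hs i
    simp only [Equiv.symm_apply_apply]
    field_simp
    ring
  continuous_toFun := by fun_prop
  continuous_invFun := by
    refine continuous_pi fun i => ?_
    have := hs (σ.symm i)
    fun_prop (disch := assumption)

theorem aff_image_union {n : ℕ} (σ : Equiv.Perm (Fin 3)) (s m : Fin 3 → ℝ) (hs : ∀ i, s i ≠ 0)
    (v : ZMod n → Fin 3 → ℝ) :
    affHomeo σ s m hs '' (⋃ j, segment ℝ (v j) (v (j + 1))) =
      ⋃ j, segment ℝ (affHomeo σ s m hs (v j)) (affHomeo σ s m hs (v (j + 1))) := by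
  rw [Set.image_iUnion]
  refine Set.iUnion_congr fun j => ?_
  have key : ∀ (α β : ℝ) (x y : Fin 3 → ℝ), α + β = 1 →
      affHomeo σ s m hs (α • x + β • y) =
        α • affHomeo σ s m hs x + β • affHomeo σ s m hs y := by
    intro α β x y h
    obtain rfl : β = 1 - α := by linarith
    funext i
    simp only [affHomeo, Homeomorph.homeomorph_mk_coe, Equiv.coe_fn_mk, Pi.add_apply,
      Pi.smul_apply, smul_eq_mul]
    ring
  ext q
  constructor
  · rintro ⟨p, ⟨α, β, hα, hβ, h, rfl⟩, rfl⟩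
    exact ⟨α, β, hα, hβ, h, (key α β _ _ h).symm⟩
  · rintro ⟨α, β, hα, hβ, h, rfl⟩
    exact ⟨_, ⟨α, β, hα, hβ, h, rfl⟩, key α β _ _ h⟩

theorem affHomeo_apply (σ : Equiv.Perm (Fin 3)) (s m : Fin 3 → ℝ) (hs : ∀ i, s i ≠ 0)
    (p : Fin 3 → ℝ) (i : Fin 3) : affHomeo σ s m hs p i = s i * (2 * p (σ i) - m i) := rfl

/-! ### Combinatorial part -/

/-- Betweenness and periodicity of one coordinate along the cycle. -/
structure IsoLine (m : ℕ) (f : ℕ → ℤ) : Prop where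
  bet : ∀ p q r, p ≤ q → q ≤ r → r ≤ p + m → (f p ≤ f q ∧ f q ≤ f r) ∨ (f r ≤ f q ∧ f q ≤ f p)
  per : ∀ k, f (k + 2 * m) = f k

theorem IsoLine.neg {m : ℕ} {f : ℕ → ℤ} (h : IsoLine m f) : IsoLine m (fun k => - f k) where
  bet := by
    intro p q r h1 h2 h3
    have := h.bet p q r h1 h2 h3
    omega
  per := by
    intro k
    have := h.per k
    omega

theorem IsoLine.mono {m : ℕ} {f : ℕ → ℤ} (h : IsoLine m f) (i k : ℕ) (hik : i ≤ k)
    (hk : k + 1 ≤ i + m) (hup : f k < f (k + 1)) (p q : ℕ) (hp : i ≤ p) (hpq : p ≤ q)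
    (hq : q ≤ i + m) : f p ≤ f q := by
  have h1 := h.bet i k (k + 1) hik (by omega) hk
  have h2 := h.bet k (k + 1) (i + m) (by omega) hk (by omega)
  have h3 := h.bet i p (i + m) hp (by omega) le_rfl
  have h4 := h.bet i q (i + m) (by omega) hq le_rfl
  have h5 := h.bet i p q hp hpq hq
  omega

theorem IsoLine.oneD_aux {m : ℕ} {f : ℕ → ℤ} (h : IsoLine m f) (j k : ℕ) (hk0 : 0 < k)
    (hkm : k < m) (hj : f j < f (j + 1)) (hk : f (j + k + 1) ≠ f (j + k)) : False := by
  have a1 := h.mono j j le_rfl (by omega) hj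
  have a2 := a1 (j + k) (j + k + 1) (by omega) (by omega) (by omega)
  have a3 := a1 (j + k + 1) (j + m) (by omega) (by omega) (by omega)
  have a4 := a1 j (j + k) (by omega) (by omega) (by omega)
  have b1 := h.mono (j + 1) (j + k) (by omega) (by omega) (by omega) (j + m) (j + 1 + m)
    (by omega) (by omega) (by omega)
  have p1 := h.per j
  have p2 := h.per (j + 1)
  have e2 : j + 1 + 2 * m = j + 2 * m + 1 := by omega
  rw [e2] at p2
  have c1 := h.mono (j + 1 + m) (j + 2 * m) (by omega) (by omega) (by omega) (j + 1 + m)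
    (j + 2 * m) (by omega) (by omega) (by omega)
  omega

theorem IsoLine.oneD {m : ℕ} {f : ℕ → ℤ} (h : IsoLine m f) (j k : ℕ) (hk0 : 0 < k)
    (hkm : k < m) (hj : f (j + 1) ≠ f j) : f (j + k + 1) = f (j + k) := by
  by_contra hk
  rcases lt_or_gt_of_ne hj with h1 | h1
  · exact h.neg.oneD_aux j k hk0 hkm (by simpa using h1) (by simpa using hk)
  · exact h.oneD_aux j k hk0 hkm h1 hk

theorem IsoLine.plateau1 {m : ℕ} {f : ℕ → ℤ} (h : IsoLine m f) (j : ℕ) (hj : f (j + 1) ≠ f j)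
    (t : ℕ) (ht : t + 1 ≤ m) : f (j + (t + 1)) = f (j + 1) := by
  induction t with
  | zero => rfl
  | succ t ih =>
    rw [← ih (by omega)]
    exact h.oneD j (t + 1) (by omega) (by omega) hj

theorem IsoLine.plateau2 {m : ℕ} {f : ℕ → ℤ} (h : IsoLine m f) (j : ℕ) (hj : f (j + 1) ≠ f j)
    (t : ℕ) (ht : t + 1 ≤ m) : f (j + m + (t + 1)) = f j := by
  have key : ∀ t, t + 1 ≤ m → f (j + m + (t + 1)) = f (j + m + 1) := by
    intro t
    induction t with
    | zero => intro _; rfl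
    | succ t ih =>
      intro ht
      rw [← ih (by omega)]
      by_contra hne
      have h1 := h.oneD (j + m + (t + 1)) (m - (t + 1)) (by omega) (by omega) hne
      have e1 : j + m + (t + 1) + (m - (t + 1)) = j + 2 * m := by omega
      have e2 : j + 2 * m + 1 = j + 1 + 2 * m := by omega
      rw [e1, e2, h.per, h.per] at h1
      exact hj h1
  rw [key t ht, ← key (m - 1) (by omega), ← h.per j]
  congr 1
  omega

theorem IsoLine.range {m : ℕ} {f : ℕ → ℤ} (h : IsoLine m f)
    (hs : ∀ k, f (k + 1) ≤ f k + 1 ∧ f k ≤ f (k + 1) + 1) (p t : ℕ) (ht : t ≤ m) :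
    f (p + t) ≤ f p + 1 ∧ f p ≤ f (p + t) + 1 := by
  have key : f (p + t) = f p ∨ (∃ k < t, f (p + k + 1) ≠ f (p + k)) ∧
      f (p + t) ≤ f p + 1 ∧ f p ≤ f (p + t) + 1 := by
    induction t with
    | zero => left; rfl
    | succ t ih =>
      have hst := hs (p + t)
      by_cases hc : f (p + t + 1) = f (p + t)
      · rw [← Nat.add_assoc, hc]
        rcases ih (by omega) with h1 | ⟨⟨k, hk, h1⟩, h2⟩
        · left; exact h1
        · right; exact ⟨⟨k, by omega, h1⟩, h2⟩
      · rcases ih (by omega) with h1 | ⟨⟨k, hk, h1⟩, h2⟩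
        · right
          refine ⟨⟨t, by omega, hc⟩, ?_⟩
          rw [← Nat.add_assoc]
          omega
        · exfalso
          have := h.oneD (p + k) (t - k) (by omega) (by omega) h1
          have e : p + k + (t - k) = p + t := by omega
          rw [e] at this
          exact hc this
  rcases key with h1 | ⟨-, h1⟩
  · omega
  · exact h1

theorem d1_expand (a b : Fin 3 → ℤ) :
    d1 a b = |a 0 - b 0| + |a 1 - b 1| + |a 2 - b 2| := by
  simp [d1, Fin.sum_univ_three]

theorem d1_triangle (a b c : Fin 3 → ℤ) : d1 a c ≤ d1 a b + d1 b c := by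
  simp only [d1_expand]
  have h0 := abs_sub_le (a 0) (b 0) (c 0)
  have h1 := abs_sub_le (a 1) (b 1) (c 1)
  have h2 := abs_sub_le (a 2) (b 2) (c 2)
  omega

theorem d1_pos {a b : Fin 3 → ℤ} (h : a ≠ b) : 0 < d1 a b := by
  by_contra hc
  apply h
  rw [d1_expand] at hc
  have h0 := abs_nonneg (a 0 - b 0)
  have h1 := abs_nonneg (a 1 - b 1)
  have h2 := abs_nonneg (a 2 - b 2)
  have g0 : |a 0 - b 0| = 0 := by omega
  have g1 : |a 1 - b 1| = 0 := by omega
  have g2 : |a 2 - b 2| = 0 := by omega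
  rw [abs_eq_zero] at g0 g1 g2
  funext i
  fin_cases i
  · exact sub_eq_zero.1 g0
  · exact sub_eq_zero.1 g1
  · exact sub_eq_zero.1 g2

theorem d1_one {a b : Fin 3 → ℤ} (h : d1 b a = 1) :
    ∃ c : Fin 3, ∃ e : ℤ, (e = 1 ∨ e = -1) ∧ b c = a c + e ∧ ∀ c', c' ≠ c → b c' = a c' := by
  rw [d1_expand] at h
  have hc : (b 0 - a 0 = 0 ∧ b 1 - a 1 = 0 ∧ |b 2 - a 2| = 1) ∨
      (b 0 - a 0 = 0 ∧ |b 1 - a 1| = 1 ∧ b 2 - a 2 = 0) ∨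
      (|b 0 - a 0| = 1 ∧ b 1 - a 1 = 0 ∧ b 2 - a 2 = 0) := by
    have h0 := abs_nonneg (b 0 - a 0)
    have h1 := abs_nonneg (b 1 - a 1)
    have h2 := abs_nonneg (b 2 - a 2)
    have g0 := abs_eq_zero (a := b 0 - a 0)
    have g1 := abs_eq_zero (a := b 1 - a 1)
    have g2 := abs_eq_zero (a := b 2 - a 2)
    rw [← g0, ← g1, ← g2]
    omega
  rcases hc with ⟨h0, h1, h2⟩ | ⟨h0, h1, h2⟩ | ⟨h0, h1, h2⟩
  · refine ⟨2, b 2 - a 2, eq_or_eq_neg_of_abs_eq h2, by ring, fun c' hc' => ?_⟩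
    fin_cases c' <;> simp at hc' ⊢ <;> omega
  · refine ⟨1, b 1 - a 1, eq_or_eq_neg_of_abs_eq h1, by ring, fun c' hc' => ?_⟩
    fin_cases c' <;> simp at hc' ⊢ <;> omega
  · refine ⟨0, b 0 - a 0, eq_or_eq_neg_of_abs_eq h0, by ring, fun c' hc' => ?_⟩
    fin_cases c' <;> simp at hc' ⊢ <;> omega

theorem between_of_abs {a b c : ℤ} (h : |a - c| = |a - b| + |b - c|) :
    (a ≤ b ∧ b ≤ c) ∨ (c ≤ b ∧ b ≤ a) := by
  rcases abs_cases (a - c) with h1 | h1 <;> rcases abs_cases (a - b) with h2 | h2 <;>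
    rcases abs_cases (b - c) with h3 | h3 <;> omega

theorem dK_le {n : ℕ} (K : LatticeKnot n) (h : deltaV K = 1) (i j : ZMod n) (hij : i ≠ j) :
    (dK i j : ℤ) ≤ d1 (K.vtx i) (K.vtx j) := by
  have : NeZero n := ⟨by have := K.big; omega⟩
  have hpos : 0 < d1 (K.vtx i) (K.vtx j) := d1_pos fun hc => hij (K.inj hc)
  have hfin : {x : ℝ | ∃ i j : ZMod n, i ≠ j ∧
      x = (dK i j : ℝ) / (d1 (K.vtx i) (K.vtx j) : ℝ)}.Finite := by
    refine (Set.finite_range (fun q : ZMod n × ZMod n =>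
      (dK q.1 q.2 : ℝ) / (d1 (K.vtx q.1) (K.vtx q.2) : ℝ))).subset ?_
    rintro x ⟨i, j, -, rfl⟩
    exact ⟨(i, j), rfl⟩
  have hle : (dK i j : ℝ) / (d1 (K.vtx i) (K.vtx j) : ℝ) ≤ 1 := by
    rw [← h]
    exact le_csSup hfin.bddAbove ⟨i, j, hij, rfl⟩
  have hpos' : (0 : ℝ) < (d1 (K.vtx i) (K.vtx j) : ℝ) := by exact_mod_cast hpos
  rw [div_le_one hpos'] at hle
  exact_mod_cast hle

theorem step_one {n : ℕ} (K : LatticeKnot n) (k : ℕ) :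
    d1 (K.vtx ((k + 1 : ℕ) : ZMod n)) (K.vtx (k : ZMod n)) = 1 := by
  have := K.step_unit (k : ZMod n)
  rwa [← Nat.cast_succ] at this

theorem d1_comm (a b : Fin 3 → ℤ) : d1 a b = d1 b a := by
  simp only [d1, abs_sub_comm]

theorem dist_le {n : ℕ} (K : LatticeKnot n) (k r : ℕ) :
    d1 (K.vtx (k : ZMod n)) (K.vtx ((k + r : ℕ) : ZMod n)) ≤ r := by
  induction r with
  | zero => simp [d1]
  | succ r ih =>
    have h1 := step_one K (k + r)
    have h2 := d1_triangle (K.vtx (k : ZMod n)) (K.vtx ((k + r : ℕ) : ZMod n))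
      (K.vtx ((k + r + 1 : ℕ) : ZMod n))
    rw [d1_comm] at h1
    rw [← Nat.add_assoc]
    push_cast at *
    omega

theorem dist_eq {n : ℕ} (K : LatticeKnot n) (h : deltaV K = 1) (k r : ℕ) (hr : 2 * r ≤ n) :
    d1 (K.vtx (k : ZMod n)) (K.vtx ((k + r : ℕ) : ZMod n)) = r := by
  have hn := K.big
  have : NeZero n := ⟨by omega⟩
  refine le_antisymm (dist_le K k r) ?_
  rcases Nat.eq_zero_or_pos r with rfl | hpos
  · simp [d1]
  have e1 : ((k + r : ℕ) : ZMod n) - (k : ZMod n) = ((r : ℕ) : ZMod n) := by push_cast; ring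
  have e2 : (k : ZMod n) - ((k + r : ℕ) : ZMod n) = ((n - r : ℕ) : ZMod n) := by
    rw [Nat.cast_sub (by omega)]; push_cast; simp
  have v1 : ((r : ℕ) : ZMod n).val = r := ZMod.val_cast_of_lt (by omega)
  have v2 : ((n - r : ℕ) : ZMod n).val = n - r := ZMod.val_cast_of_lt (by omega)
  have hne : (k : ZMod n) ≠ ((k + r : ℕ) : ZMod n) := by
    intro hc
    rw [← hc, sub_self] at e1
    rw [← e1] at v1
    simp at v1
    omega
  have hd : dK (k : ZMod n) ((k + r : ℕ) : ZMod n) = r := by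
    rw [dK, e1, e2, v1, v2]
    omega
  have := dK_le K h _ _ hne
  rwa [hd] at this

theorem even_len {n : ℕ} (K : LatticeKnot n) : ∃ m, n = 2 * m := by
  have key : ∀ k : ℕ, (K.vtx (k : ZMod n) 0 + K.vtx (k : ZMod n) 1 + K.vtx (k : ZMod n) 2
      - (K.vtx 0 0 + K.vtx 0 1 + K.vtx 0 2) - k) % 2 = 0 := by
    intro k
    induction k with
    | zero => simp
    | succ k ih =>
      obtain ⟨c, e, he, h1, h2⟩ := d1_one (step_one K k)
      have h20 := h2 0
      have h21 := h2 1
      have h22 := h2 2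
      fin_cases c <;> simp at h1 h20 h21 h22 <;> push_cast at * <;> omega
  have := key n
  simp at this
  exact ⟨n / 2, by omega⟩

theorem isoLine {m : ℕ} (K : LatticeKnot (2 * m)) (h : deltaV K = 1) (c : Fin 3) :
    IsoLine m (fun k => K.vtx (k : ZMod (2 * m)) c) where
  per := by
    intro k
    have : ((k + 2 * m : ℕ) : ZMod (2 * m)) = (k : ZMod (2 * m)) := by
      rw [Nat.cast_add, ZMod.natCast_self, add_zero]
    simp only [this]
  bet := by
    intro p q r hpq hqr hr
    obtain ⟨s, rfl⟩ := Nat.exists_eq_add_of_le hpq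
    obtain ⟨t, rfl⟩ := Nat.exists_eq_add_of_le hqr
    have h1 := dist_eq K h p s (by omega)
    have h2 := dist_eq K h (p + s) t (by omega)
    have h3 := dist_eq K h p (s + t) (by omega)
    rw [← Nat.add_assoc] at h3
    apply between_of_abs
    rw [d1_expand] at h1 h2 h3
    have g := fun c => abs_sub_le (K.vtx (p : ZMod (2 * m)) c)
      (K.vtx ((p + s : ℕ) : ZMod (2 * m)) c) (K.vtx ((p + s + t : ℕ) : ZMod (2 * m)) c)
    have g0 := g 0
    have g1 := g 1
    have g2 := g 2
    fin_cases c <;> simp only [Fin.zero_eta, Fin.mk_one, Fin.reduceFinMk] <;> omega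

theorem step_small {m : ℕ} (K : LatticeKnot (2 * m)) (c : Fin 3) (k : ℕ) :
    K.vtx ((k + 1 : ℕ) : ZMod (2 * m)) c ≤ K.vtx (k : ZMod (2 * m)) c + 1 ∧
    K.vtx (k : ZMod (2 * m)) c ≤ K.vtx ((k + 1 : ℕ) : ZMod (2 * m)) c + 1 := by
  obtain ⟨c', e, he, h1, h2⟩ := d1_one (step_one K k)
  by_cases hc : c = c'
  · subst hc; omega
  · have := h2 c hc; omega

theorem coord_range {m : ℕ} (K : LatticeKnot (2 * m)) (h : deltaV K = 1) (c : Fin 3)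
    (i j : ZMod (2 * m)) : K.vtx i c ≤ K.vtx j c + 1 := by
  have hn := K.big
  have : NeZero (2 * m) := ⟨by omega⟩
  have hL := isoLine K h c
  have ei : ((i.val : ℕ) : ZMod (2 * m)) = i := ZMod.natCast_zmod_val i
  have ej : ((j.val : ℕ) : ZMod (2 * m)) = j := ZMod.natCast_zmod_val j
  by_cases hr : (j - i).val ≤ m
  · have := (hL.range (step_small K c) i.val (j - i).val hr).2
    have e : ((i.val + (j - i).val : ℕ) : ZMod (2 * m)) = j := by
      rw [Nat.cast_add, ei, ZMod.natCast_zmod_val]; ring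
    simpa only [e, ei] using this
  · have hr' : (i - j).val ≤ m := by
      have hne : NeZero (j - i) := ⟨by
        intro h0; rw [h0] at hr; simp at hr⟩
      have h2 := ZMod.val_neg_of_ne_zero (j - i)
      rw [neg_sub] at h2
      omega
    have := (hL.range (step_small K c) j.val (i - j).val hr').1
    have e : ((j.val + (i - j).val : ℕ) : ZMod (2 * m)) = i := by
      rw [Nat.cast_add, ej, ZMod.natCast_zmod_val]; ring
    simpa only [e, ej] using this

theorem len_le {m : ℕ} (K : LatticeKnot (2 * m)) (h : deltaV K = 1) : m ≤ 3 := by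
  by_contra hm
  have key : ∀ c0 c1 c2 c3 : Fin 3, c0 ≠ c1 → c0 ≠ c2 → c0 ≠ c3 → c1 ≠ c2 → c1 ≠ c3 →
      ¬ c2 ≠ c3 := by decide
  have st := fun k : ℕ => d1_one (step_one K k)
  choose a e he h1 h2 using st
  have ne : ∀ j k, 0 < k → k < m → a j ≠ a (j + k) := by
    intro j k hk hkm hc
    have hL := isoLine K h (a j)
    have h3 := hL.oneD j k hk hkm (by
      have := h1 j; have := he j
      show K.vtx ((j + 1 : ℕ) : ZMod (2 * m)) (a j) ≠ K.vtx ((j : ℕ) : ZMod (2 * m)) (a j)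
      omega)
    rw [hc] at h3
    have := h1 (j + k); have := he (j + k)
    omega
  exact key (a 0) (a 1) (a 2) (a 3) (ne 0 1 (by omega) (by omega)) (ne 0 2 (by omega) (by omega))
    (ne 0 3 (by omega) (by omega)) (ne 1 1 (by omega) (by omega)) (ne 1 2 (by omega) (by omega))
    (ne 2 1 (by omega) (by omega))

theorem sign_low (e x y : ℤ) (he : e = 1 ∨ e = -1) (h : y = x) :
    (e : ℝ) * (2 * (y : ℝ) - (2 * (x : ℝ) + e)) = -1 := by
  subst h
  rcases he with rfl | rfl <;> push_cast <;> ring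

theorem sign_high (e x y : ℤ) (he : e = 1 ∨ e = -1) (h : y = x + e) :
    (e : ℝ) * (2 * (y : ℝ) - (2 * (x : ℝ) + e)) = 1 := by
  subst h
  rcases he with rfl | rfl <;> push_cast <;> ring

theorem unknot_of_union {n : ℕ} (v : ZMod n → Fin 3 → ℝ) (S C : Set (Fin 3 → ℝ))
    (σ : Equiv.Perm (Fin 3)) (s m : Fin 3 → ℝ) (hs : ∀ i, s i ≠ 0)
    (hS : ∃ F : (Fin 3 → ℝ) ≃ₜ (Fin 3 → ℝ), F '' S = C)
    (hU : ⋃ j, segment ℝ (affHomeo σ s m hs (v j)) (affHomeo σ s m hs (v (j + 1))) = S) :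
    ∃ F : (Fin 3 → ℝ) ≃ₜ (Fin 3 → ℝ), F '' (⋃ j, segment ℝ (v j) (v (j + 1))) = C := by
  obtain ⟨F, hF⟩ := hS
  refine ⟨(affHomeo σ s m hs).trans F, ?_⟩
  have hc : ⇑((affHomeo σ s m hs).trans F) = F ∘ affHomeo σ s m hs := rfl
  rw [hc, Set.image_comp, aff_image_union, hU, hF]

/-- The permutation determined by three distinct axes. -/
theorem exists_perm (c0 c1 c2 : Fin 3) (h01 : c0 ≠ c1) (h02 : c0 ≠ c2) (h12 : c1 ≠ c2) :
    ∃ σ : Equiv.Perm (Fin 3), σ 0 = c0 ∧ σ 1 = c1 ∧ σ 2 = c2 := by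
  revert c0 c1 c2
  decide

theorem unknot_hex (K : LatticeKnot (2 * 3)) (h : deltaV K = 1) :
    ∃ F : (Fin 3 → ℝ) ≃ₜ (Fin 3 → ℝ),
      F '' (⋃ j : ZMod (2 * 3),
          segment ℝ (fun c => (K.vtx j c : ℝ)) (fun c => (K.vtx (j + 1) c : ℝ))) =
        {p : Fin 3 → ℝ | p 0 ^ 2 + p 1 ^ 2 = 1 ∧ p 2 = 0} := by
  obtain ⟨c0, e0, he0, a0, b0⟩ := d1_one (step_one K 0)
  obtain ⟨c1, e1, he1, a1, b1⟩ := d1_one (step_one K 1)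
  obtain ⟨c2, e2, he2, a2, b2⟩ := d1_one (step_one K 2)
  have L0 := isoLine K h c0
  have L1 := isoLine K h c1
  have L2 := isoLine K h c2
  have n0 : K.vtx ((0 + 1 : ℕ) : ZMod (2 * 3)) c0 ≠ K.vtx ((0 : ℕ) : ZMod (2 * 3)) c0 := by omega
  have n1 : K.vtx ((1 + 1 : ℕ) : ZMod (2 * 3)) c1 ≠ K.vtx ((1 : ℕ) : ZMod (2 * 3)) c1 := by omega
  have n2 : K.vtx ((2 + 1 : ℕ) : ZMod (2 * 3)) c2 ≠ K.vtx ((2 : ℕ) : ZMod (2 * 3)) c2 := by omega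
  have h01 : c0 ≠ c1 := by
    rintro rfl
    exact n1 (L0.oneD 0 1 (by omega) (by omega) n0)
  have h02 : c0 ≠ c2 := by
    rintro rfl
    exact n2 (L0.oneD 0 2 (by omega) (by omega) n0)
  have h12 : c1 ≠ c2 := by
    rintro rfl
    exact n2 (L1.oneD 1 1 (by omega) (by omega) n1)
  obtain ⟨σ, s0, s1, s2⟩ := exists_perm c0 c1 c2 h01 h02 h12
  have p02 : K.vtx 2 c0 = K.vtx 1 c0 := L0.plateau1 0 n0 1 (by omega)
  have p03 : K.vtx 3 c0 = K.vtx 1 c0 := L0.plateau1 0 n0 2 (by omega)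
  have p04 : K.vtx 4 c0 = K.vtx 0 c0 := L0.plateau2 0 n0 0 (by omega)
  have p05 : K.vtx 5 c0 = K.vtx 0 c0 := L0.plateau2 0 n0 1 (by omega)
  have p13 : K.vtx 3 c1 = K.vtx 2 c1 := L1.plateau1 1 n1 1 (by omega)
  have p14 : K.vtx 4 c1 = K.vtx 2 c1 := L1.plateau1 1 n1 2 (by omega)
  have p15 : K.vtx 5 c1 = K.vtx 1 c1 := L1.plateau2 1 n1 0 (by omega)
  have p10 : K.vtx 0 c1 = K.vtx 1 c1 := L1.plateau2 1 n1 1 (by omega)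
  have p24 : K.vtx 4 c2 = K.vtx 3 c2 := L2.plateau1 2 n2 1 (by omega)
  have p25 : K.vtx 5 c2 = K.vtx 3 c2 := L2.plateau1 2 n2 2 (by omega)
  have p20 : K.vtx 0 c2 = K.vtx 2 c2 := L2.plateau2 2 n2 0 (by omega)
  have p21 : K.vtx 1 c2 = K.vtx 2 c2 := L2.plateau2 2 n2 1 (by omega)
  have q0 : K.vtx 1 c0 = K.vtx 0 c0 + e0 := by simpa using a0
  have q1 : K.vtx 2 c1 = K.vtx 1 c1 + e1 := a1
  have q2 : K.vtx 3 c2 = K.vtx 2 c2 + e2 := a2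
  clear a0 a1 a2 b0 b1 b2 n0 n1 n2 L0 L1 L2
  have hs : ∀ i, (![(e0 : ℝ), -(e1 : ℝ), (e2 : ℝ)] : Fin 3 → ℝ) i ≠ 0 := by
    intro i
    fin_cases i
    · rcases he0 with rfl | rfl <;> simp
    · rcases he1 with rfl | rfl <;> simp
    · rcases he2 with rfl | rfl <;> simp
  refine unknot_of_union (fun j c => (K.vtx j c : ℝ)) hexSet _ σ _
    ![2 * (K.vtx 0 c0 : ℝ) + e0, 2 * (K.vtx 0 c1 : ℝ) + e1, 2 * (K.vtx 0 c2 : ℝ) + e2] hs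
    hexSet_circle ?_
  have fin : ∀ (j : ZMod (2 * 3)) (r0 r1 r2 : ℝ),
      (e0 : ℝ) * (2 * (K.vtx j c0 : ℝ) - (2 * (K.vtx 0 c0 : ℝ) + e0)) = r0 →
      (e1 : ℝ) * (2 * (K.vtx j c1 : ℝ) - (2 * (K.vtx 0 c1 : ℝ) + e1)) = -r1 →
      (e2 : ℝ) * (2 * (K.vtx j c2 : ℝ) - (2 * (K.vtx 0 c2 : ℝ) + e2)) = r2 →
      affHomeo σ _ ![2 * (K.vtx 0 c0 : ℝ) + e0, 2 * (K.vtx 0 c1 : ℝ) + e1,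
        2 * (K.vtx 0 c2 : ℝ) + e2] hs (fun c => (K.vtx j c : ℝ)) = ![r0, r1, r2] := by
    intro j r0 r1 r2 g0 g1 g2
    funext i
    rw [affHomeo_apply]
    fin_cases i
    · simpa [s0] using g0
    · simp only [Fin.mk_one, Matrix.cons_val_one, Matrix.cons_val_zero, s1]
      linarith
    · simpa [s2] using g2
  refine hex_union (fun j => affHomeo σ _ _ hs (fun c => (K.vtx j c : ℝ))) ?_ ?_ ?_ ?_ ?_ ?_
  · exact fin 0 (-1) 1 (-1) (sign_low _ _ _ he0 (by omega)) (sign_low _ _ _ he1 (by omega))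
      (sign_low _ _ _ he2 (by omega))
  · exact fin 1 1 1 (-1) (sign_high _ _ _ he0 (by omega)) (sign_low _ _ _ he1 (by omega))
      (sign_low _ _ _ he2 (by omega))
  · exact fin 2 1 (-1) (-1) (sign_high _ _ _ he0 (by omega))
      ((sign_high _ _ _ he1 (by omega)).trans (by norm_num)) (sign_low _ _ _ he2 (by omega))
  · exact fin 3 1 (-1) 1 (sign_high _ _ _ he0 (by omega))
      ((sign_high _ _ _ he1 (by omega)).trans (by norm_num)) (sign_high _ _ _ he2 (by omega))
  · exact fin 4 (-1) (-1) 1 (sign_low _ _ _ he0 (by omega))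
      ((sign_high _ _ _ he1 (by omega)).trans (by norm_num)) (sign_high _ _ _ he2 (by omega))
  · exact fin 5 (-1) 1 1 (sign_low _ _ _ he0 (by omega)) (sign_low _ _ _ he1 (by omega))
      (sign_high _ _ _ he2 (by omega))

theorem unknot_sq (K : LatticeKnot (2 * 2)) (h : deltaV K = 1) :
    ∃ F : (Fin 3 → ℝ) ≃ₜ (Fin 3 → ℝ),
      F '' (⋃ j : ZMod (2 * 2),
          segment ℝ (fun c => (K.vtx j c : ℝ)) (fun c => (K.vtx (j + 1) c : ℝ))) =
        {p : Fin 3 → ℝ | p 0 ^ 2 + p 1 ^ 2 = 1 ∧ p 2 = 0} := by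
  obtain ⟨c0, e0, he0, a0, b0⟩ := d1_one (step_one K 0)
  obtain ⟨c1, e1, he1, a1, b1⟩ := d1_one (step_one K 1)
  obtain ⟨c3, e3, he3, a3, b3⟩ := d1_one (step_one K 2)
  have L0 := isoLine K h c0
  have L1 := isoLine K h c1
  have n0 : K.vtx ((0 + 1 : ℕ) : ZMod (2 * 2)) c0 ≠ K.vtx ((0 : ℕ) : ZMod (2 * 2)) c0 := by omega
  have n1 : K.vtx ((1 + 1 : ℕ) : ZMod (2 * 2)) c1 ≠ K.vtx ((1 : ℕ) : ZMod (2 * 2)) c1 := by omega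
  have h01 : c0 ≠ c1 := by
    rintro rfl
    exact n1 (L0.oneD 0 1 (by omega) (by omega) n0)
  obtain ⟨c2, h02, h12⟩ : ∃ c2, c0 ≠ c2 ∧ c1 ≠ c2 := by
    clear * - h01
    revert c0 c1
    decide
  obtain ⟨σ, s0, s1, s2⟩ := exists_perm c0 c1 c2 h01 h02 h12
  have p02 : K.vtx 2 c0 = K.vtx 1 c0 := L0.plateau1 0 n0 1 (by omega)
  have p03 : K.vtx 3 c0 = K.vtx 0 c0 := L0.plateau2 0 n0 0 (by omega)
  have p13 : K.vtx 3 c1 = K.vtx 2 c1 := L1.plateau1 1 n1 1 (by omega)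
  have p10 : K.vtx 0 c1 = K.vtx 1 c1 := L1.plateau2 1 n1 0 (by omega)
  have q0 : K.vtx 1 c0 = K.vtx 0 c0 + e0 := by simpa using a0
  have q1 : K.vtx 2 c1 = K.vtx 1 c1 + e1 := a1
  have q21 : K.vtx 1 c2 = K.vtx 0 c2 := by simpa using b0 c2 h02.symm
  have q22 : K.vtx 2 c2 = K.vtx 1 c2 := b1 c2 h12.symm
  have h03 : c0 = c3 := by
    by_contra hc
    have : K.vtx 3 c0 = K.vtx 2 c0 := b3 c0 hc
    omega
  have q23 : K.vtx 3 c2 = K.vtx 2 c2 := b3 c2 (h03 ▸ h02.symm)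
  clear a0 a1 a3 b0 b1 b3 n0 n1 L0 L1
  have hs : ∀ i, (![(e0 : ℝ), (e1 : ℝ), 1] : Fin 3 → ℝ) i ≠ 0 := by
    intro i
    fin_cases i
    · rcases he0 with rfl | rfl <;> simp
    · rcases he1 with rfl | rfl <;> simp
    · simp
  refine unknot_of_union (fun j c => (K.vtx j c : ℝ)) sqSet _ σ _
    ![2 * (K.vtx 0 c0 : ℝ) + e0, 2 * (K.vtx 0 c1 : ℝ) + e1, 2 * (K.vtx 0 c2 : ℝ)] hs
    sqSet_circle ?_
  have fin : ∀ (j : ZMod (2 * 2)) (r0 r1 : ℝ),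
      (e0 : ℝ) * (2 * (K.vtx j c0 : ℝ) - (2 * (K.vtx 0 c0 : ℝ) + e0)) = r0 →
      (e1 : ℝ) * (2 * (K.vtx j c1 : ℝ) - (2 * (K.vtx 0 c1 : ℝ) + e1)) = r1 →
      K.vtx j c2 = K.vtx 0 c2 →
      affHomeo σ _ ![2 * (K.vtx 0 c0 : ℝ) + e0, 2 * (K.vtx 0 c1 : ℝ) + e1,
        2 * (K.vtx 0 c2 : ℝ)] hs (fun c => (K.vtx j c : ℝ)) = ![r0, r1, 0] := by
    intro j r0 r1 g0 g1 g2
    funext i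
    rw [affHomeo_apply]
    fin_cases i
    · simpa [s0] using g0
    · simpa [s1] using g1
    · simp [s2, g2]
  refine sq_union (fun j => affHomeo σ _ _ hs (fun c => (K.vtx j c : ℝ))) ?_ ?_ ?_ ?_
  · exact fin 0 (-1) (-1) (sign_low _ _ _ he0 (by omega)) (sign_low _ _ _ he1 (by omega)) rfl
  · exact fin 1 1 (-1) (sign_high _ _ _ he0 (by omega)) (sign_low _ _ _ he1 (by omega)) (by omega)
  · exact fin 2 1 1 (sign_high _ _ _ he0 (by omega)) (sign_high _ _ _ he1 (by omega)) (by omega)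
  · exact fin 3 (-1) 1 (sign_low _ _ _ he0 (by omega)) (sign_high _ _ _ he1 (by omega)) (by omega)

theorem not_interior_Icc (lo hi p : Fin 3 → ℝ) (c : Fin 3) (h : p c = lo c ∨ p c = hi c) :
    p ∉ interior (Set.Icc lo hi) := by
  intro hp
  rw [← Set.pi_univ_Icc, interior_pi_set Set.finite_univ] at hp
  have : p c ∈ interior (Set.Icc (lo c) (hi c)) := hp c (Set.mem_univ c)
  rw [interior_Icc] at this
  rcases h with h | h
  · exact absurd this.1 (by rw [h]; exact lt_irrefl _)
  · exact absurd this.2 (by rw [h]; exact lt_irrefl _)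

/-- If a lattice knot `K` has vertex distortion 1, then every vertex of `K` is a corner
of the minimal bounding box (each of its coordinates is an upper or lower bound on the
corresponding coordinates of all vertices); consequently `K` (the union of its edges)
lies in the boundary of its minimal bounding box, and `K` is the unknot (there is a
homeomorphism of ℝ³ carrying `K` onto the standard round circle). -/
theorem stmt10 (n : ℕ) (K : LatticeKnot n) (h : deltaV K = 1) :
    (∀ j : ZMod n, ∀ c : Fin 3,
      (∀ i, K.vtx j c ≤ K.vtx i c) ∨ (∀ i, K.vtx i c ≤ K.vtx j c)) ∧
    (∀ lo hi : Fin 3 → ℤ,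
      (∀ c, IsLeast {z : ℤ | ∃ i, K.vtx i c = z} (lo c)) →
      (∀ c, IsGreatest {z : ℤ | ∃ i, K.vtx i c = z} (hi c)) →
      ∀ j : ZMod n,
        segment ℝ (fun c => (K.vtx j c : ℝ)) (fun c => (K.vtx (j + 1) c : ℝ)) ⊆
          frontier (Set.Icc (fun c => (lo c : ℝ)) (fun c => (hi c : ℝ)))) ∧
    (∃ F : (Fin 3 → ℝ) ≃ₜ (Fin 3 → ℝ),
      F '' (⋃ j : ZMod n,
          segment ℝ (fun c => (K.vtx j c : ℝ)) (fun c => (K.vtx (j + 1) c : ℝ))) =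
        {p : Fin 3 → ℝ | p 0 ^ 2 + p 1 ^ 2 = 1 ∧ p 2 = 0}) := by
  obtain ⟨m, rfl⟩ := even_len K
  have hbig := K.big
  have hm := len_le K h
  have corner : ∀ j : ZMod (2 * m), ∀ c : Fin 3,
      (∀ i, K.vtx j c ≤ K.vtx i c) ∨ (∀ i, K.vtx i c ≤ K.vtx j c) := by
    intro j c
    by_contra hc
    push Not at hc
    obtain ⟨⟨i, hi⟩, ⟨k, hk⟩⟩ := hc
    have := coord_range K h c k i
    omega
  refine ⟨corner, ?_, ?_⟩
  · intro lo hi hlo hhi j p hp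
    have hmem : ∀ i : ZMod (2 * m), (fun c => (K.vtx i c : ℝ)) ∈
        Set.Icc (fun c => (lo c : ℝ)) (fun c => (hi c : ℝ)) := by
      intro i
      constructor
      · intro c
        have : lo c ≤ K.vtx i c := (hlo c).2 ⟨i, rfl⟩
        exact Int.cast_le.2 this
      · intro c
        have : K.vtx i c ≤ hi c := (hhi c).2 ⟨i, rfl⟩
        exact Int.cast_le.2 this
    have hIcc := (convex_Icc (fun c => (lo c : ℝ)) (fun c => (hi c : ℝ))).segment_subset
      (hmem j) (hmem (j + 1)) hp
    refine ⟨subset_closure hIcc, ?_⟩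
    obtain ⟨a, e, -, -, hrest⟩ := d1_one (K.step_unit j)
    obtain ⟨c, hc⟩ : ∃ c : Fin 3, c ≠ a := exists_ne a
    have hconst : p c = (K.vtx j c : ℝ) := by
      obtain ⟨α, β, -, -, hs, rfl⟩ := hp
      have hcc := hrest c hc
      simp only [Pi.add_apply, Pi.smul_apply, smul_eq_mul, hcc]
      rw [← add_mul, hs, one_mul]
    refine not_interior_Icc _ _ p c ?_
    rw [hconst]
    rcases corner j c with h1 | h1
    · left
      obtain ⟨i, hi'⟩ := (hlo c).1
      have h2 : lo c ≤ K.vtx j c := (hlo c).2 ⟨j, rfl⟩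
      have h3 : K.vtx j c = lo c := le_antisymm (hi' ▸ h1 i) h2
      exact_mod_cast h3
    · right
      obtain ⟨i, hi'⟩ := (hhi c).1
      have h2 : K.vtx j c ≤ hi c := (hhi c).2 ⟨j, rfl⟩
      have h3 : K.vtx j c = hi c := le_antisymm h2 (hi' ▸ h1 i)
      exact_mod_cast h3
  · obtain rfl | rfl : m = 2 ∨ m = 3 := by omega
    · exact unknot_sq K h
    · exact unknot_hex K h
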